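/- If station s1 dominates station s2 (i.e., every connection containing s2 also contains s1), then there exists an optimal station cover that does not contain s2. -/

import Mathlib

/-- If station `s1` dominates station `s2` (every connection containing `s2` also
contains `s1`), then there exists an optimal station cover not containing `s2`. -/
theorem stmt0 {α : Type*} [Fintype α] [DecidableEq α]
    (C : Finset (Finset α)) (hne : ∀ c ∈ C, c.Nonempty)
    (s1 s2 : α) (hs : s1 ≠ s2)
    (hdom : ∀ c ∈ C, s2 ∈ c → s1 ∈ c) :
    ∃ S' : Finset α, (∀ c ∈ C, (S' ∩ c).Nonempty) ∧ s2 ∉ S' ∧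
      ∀ S'' : Finset α, (∀ c ∈ C, (S'' ∩ c).Nonempty) → S'.card ≤ S''.card := by
  have hcov : ((Finset.univ : Finset (Finset α)).filter
      (fun S => ∀ c ∈ C, (S ∩ c).Nonempty)).Nonempty :=
    ⟨Finset.univ, by simpa using hne⟩
  obtain ⟨T, hT, hmin⟩ := Finset.exists_min_image _ Finset.card hcov
  have hT' : ∀ c ∈ C, (T ∩ c).Nonempty := (Finset.mem_filter.1 hT).2
  have hmin' : ∀ S : Finset α, (∀ c ∈ C, (S ∩ c).Nonempty) → T.card ≤ S.card :=
    fun S h => hmin S (Finset.mem_filter.2 ⟨Finset.mem_univ _, h⟩)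
  by_cases h2 : s2 ∈ T
  · refine ⟨insert s1 (T.erase s2), ?_, ?_, ?_⟩
    · intro c hc
      obtain ⟨x, hx⟩ := hT' c hc
      rw [Finset.mem_inter] at hx
      by_cases hx2 : x = s2
      · subst hx2
        exact ⟨s1, Finset.mem_inter.2 ⟨Finset.mem_insert_self _ _, hdom c hc hx.2⟩⟩
      · exact ⟨x, Finset.mem_inter.2
          ⟨Finset.mem_insert_of_mem (Finset.mem_erase.2 ⟨hx2, hx.1⟩), hx.2⟩⟩
    · simp [hs.symm]
    · intro S h
      have h3 := Finset.card_insert_le s1 (T.erase s2)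
      have h4 := Finset.card_erase_add_one h2
      have h5 := hmin' S h
      omega
  · exact ⟨T, hT', h2, hmin'⟩
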